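/- arXiv:2505.21186 — 11 statements merged into one kernel-verified Lean document; each statement's English description precedes it below -/
import Mathlib

section
/- Let the two-dimensional torus (ℂ*)² act on the polynomial ring ℂ[x₁,x₂,x₃,x₄,x₅,x₆] by ℂ-algebra automorphisms, where (λ,μ) acts by x₁ ↦ λμ⁻¹x₁, x₂ ↦ λx₂, x₃ ↦ μx₃, x₄ ↦ λ⁻¹μx₄, x₅ ↦ λ⁻¹x₅, x₆ ↦ μ⁻¹x₆. Then a polynomial f ∈ ℂ[x₁,...,x₆] is invariant under this action for all (λ,μ) ∈ (ℂ*)² if and only if f lies in the ℂ-subalgebra generated by the five monomials x₁x₄, x₂x₅, x₃x₆, x₁x₃x₅, x₂x₄x₆. -/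
open MvPolynomial

/-- Rescaling the variables multiplies each coefficient by the corresponding product of powers. -/
theorem coeff_aeval_C_mul_X {σ R : Type*} [CommSemiring R] (c : σ → R)
    (f : MvPolynomial σ R) (d : σ →₀ ℕ) :
    coeff d (aeval (fun i => C (c i) * X i) f) = (d.prod fun i k => c i ^ k) * coeff d f := by
  classical
  induction f using MvPolynomial.induction_on' with
  | monomial e r =>
    have h : aeval (fun i => C (c i) * X i) (monomial e r)
        = monomial e ((e.prod fun i k => c i ^ k) * r) := by
      rw [aeval_monomial, monomial_eq, algebraMap_eq]
      simp only [mul_pow, C_mul, Finsupp.prod, map_prod, C_pow,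
        Finset.prod_mul_distrib]
      ring
    rw [h, coeff_monomial, coeff_monomial]
    split_ifs with hed
    · rw [hed]
    · simp
  | add p q hp hq => rw [map_add, coeff_add, coeff_add, hp, hq, mul_add]

/-- A monomial in six variables whose two torus weights vanish lies in the subalgebra generated
by the five basic invariant monomials. -/
theorem monomial_mem_adjoin_of_weights_eq {R : Type*} [CommSemiring R] (d : Fin 6 →₀ ℕ) (r : R)
    (h₁ : d 0 + d 1 = d 3 + d 4) (h₂ : d 2 + d 3 = d 0 + d 5) :
    monomial d r ∈ Algebra.adjoin R
      ({X 0 * X 3, X 1 * X 4, X 2 * X 5, X 0 * X 2 * X 4, X 1 * X 3 * X 5} :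
        Set (MvPolynomial (Fin 6) R)) := by
  set S : Set (MvPolynomial (Fin 6) R) :=
    {X 0 * X 3, X 1 * X 4, X 2 * X 5, X 0 * X 2 * X 4, X 1 * X 3 * X 5} with hS
  have g {p : MvPolynomial (Fin 6) R} (hp : p ∈ S) (n : ℕ) : p ^ n ∈ Algebra.adjoin R S :=
    pow_mem (Algebra.subset_adjoin hp) n
  have hC : (C r : MvPolynomial (Fin 6) R) ∈ Algebra.adjoin R S :=
    Subalgebra.algebraMap_mem _ r
  rw [monomial_eq, Finsupp.prod_fintype _ _ (fun _ => pow_zero _), Fin.prod_univ_six]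
  refine mul_mem hC ?_
  rcases le_total (d 3) (d 0) with h | h
  · obtain ⟨k, hk⟩ := Nat.exists_eq_add_of_le h
    have h4 : d 4 = d 1 + k := by omega
    have h2 : d 2 = d 5 + k := by omega
    rw [hk, h4, h2]
    convert mul_mem (mul_mem (mul_mem
      (g (p := X 0 * X 3) (by simp [hS]) (d 3)) (g (p := X 1 * X 4) (by simp [hS]) (d 1)))
      (g (p := X 2 * X 5) (by simp [hS]) (d 5))) (g (p := X 0 * X 2 * X 4) (by simp [hS]) k)
      using 1
    ring
  · obtain ⟨k, hk⟩ := Nat.exists_eq_add_of_le h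
    have h1 : d 1 = d 4 + k := by omega
    have h5 : d 5 = d 2 + k := by omega
    rw [hk, h1, h5]
    convert mul_mem (mul_mem (mul_mem
      (g (p := X 0 * X 3) (by simp [hS]) (d 0)) (g (p := X 1 * X 4) (by simp [hS]) (d 4)))
      (g (p := X 2 * X 5) (by simp [hS]) (d 2))) (g (p := X 1 * X 3 * X 5) (by simp [hS]) k)
      using 1
    ring

/-- The torus (ℂ*)² acts on ℂ[x₁,...,x₆] with weights
x₁ ↦ λμ⁻¹x₁, x₂ ↦ λx₂, x₃ ↦ μx₃, x₄ ↦ λ⁻¹μx₄, x₅ ↦ λ⁻¹x₅, x₆ ↦ μ⁻¹x₆.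
A polynomial is invariant iff it lies in the subalgebra generated by
x₁x₄, x₂x₅, x₃x₆, x₁x₃x₅, x₂x₄x₆. -/
theorem stmt_0 (f : MvPolynomial (Fin 6) ℂ) :
    (∀ l m : ℂ, l ≠ 0 → m ≠ 0 →
      aeval (fun i : Fin 6 =>
        C (![l * m⁻¹, l, m, l⁻¹ * m, l⁻¹, m⁻¹] i) * X i) f = f) ↔
    f ∈ Algebra.adjoin ℂ
      ({X 0 * X 3, X 1 * X 4, X 2 * X 5, X 0 * X 2 * X 4, X 1 * X 3 * X 5} :
        Set (MvPolynomial (Fin 6) ℂ)) := by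
  constructor
  · intro hf
    rw [f.as_sum]
    refine sum_mem fun d hd => ?_
    have key (l m : ℂ) (hl : l ≠ 0) (hm : m ≠ 0) :
        (d.prod fun i k => (![l * m⁻¹, l, m, l⁻¹ * m, l⁻¹, m⁻¹] i) ^ k) = 1 := by
      have h := coeff_aeval_C_mul_X ![l * m⁻¹, l, m, l⁻¹ * m, l⁻¹, m⁻¹] f d
      rw [hf l m hl hm] at h
      exact (mul_eq_right₀ (mem_support_iff.mp hd)).mp h.symm
    have two_pow_inj {a b : ℕ} (h : (2 : ℂ) ^ a = 2 ^ b) : a = b :=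
      Nat.pow_right_injective le_rfl (by exact_mod_cast h)
    refine monomial_mem_adjoin_of_weights_eq d _ (two_pow_inj ?_) (two_pow_inj ?_)
    · have h := key 2 1 two_ne_zero one_ne_zero
      rw [Finsupp.prod_fintype _ _ (fun _ => pow_zero _), Fin.prod_univ_six] at h
      simp at h
      field_simp at h
      rw [pow_add, pow_add]
      linear_combination h
    · have h := key 1 2 one_ne_zero two_ne_zero
      rw [Finsupp.prod_fintype _ _ (fun _ => pow_zero _), Fin.prod_univ_six] at h
      simp at h
      field_simp at h
      rw [pow_add, pow_add]
      linear_combination h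
  · intro hf l m hl hm
    have hle : Algebra.adjoin ℂ
        ({X 0 * X 3, X 1 * X 4, X 2 * X 5, X 0 * X 2 * X 4, X 1 * X 3 * X 5} :
          Set (MvPolynomial (Fin 6) ℂ)) ≤
        AlgHom.equalizer (aeval (fun i : Fin 6 =>
          C (![l * m⁻¹, l, m, l⁻¹ * m, l⁻¹, m⁻¹] i) * X i)) (AlgHom.id ℂ _) := by
      have hl' : (C l * C l⁻¹ : MvPolynomial (Fin 6) ℂ) = 1 := by
        rw [← C_mul, mul_inv_cancel₀ hl, C_1]
      have hm' : (C m * C m⁻¹ : MvPolynomial (Fin 6) ℂ) = 1 := by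
        rw [← C_mul, mul_inv_cancel₀ hm, C_1]
      have hlm : (C l * C l⁻¹ * (C m * C m⁻¹) : MvPolynomial (Fin 6) ℂ) = 1 := by
        rw [hl', hm', one_mul]
      rw [Algebra.adjoin_le_iff]
      rintro p (rfl | rfl | rfl | rfl | rfl) <;>
        simp only [SetLike.mem_coe, AlgHom.mem_equalizer, map_mul, aeval_X, AlgHom.id_apply,
          Matrix.cons_val]
      · linear_combination X 0 * X 3 * hlm
      · linear_combination X 1 * X 4 * hl'
      · linear_combination X 2 * X 5 * hm'
      · linear_combination X 0 * X 2 * X 4 * hlm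
      · linear_combination X 1 * X 3 * X 5 * hlm
    exact hle hf
end

section
/- Let α, β, γ ∈ ℂ and x₁,...,x₆ ∈ ℂ. Define the 3×3 complex matrices H₁ = diag(α,β,γ), S₁ = [[1,x₁,0],[0,1,0],[0,0,1]], S₂ = [[1,0,x₂],[0,1,0],[0,0,1]], S₃ = [[1,0,0],[0,1,x₃],[0,0,1]], S₄ = [[1,0,0],[x₄,1,0],[0,0,1]], S₅ = [[1,0,0],[0,1,0],[x₅,0,1]], S₆ = [[1,0,0],[0,1,0],[0,x₆,1]], and let M = H₁S₆S₅S₄S₃S₂S₁. Set U = x₁x₄, V = x₂x₅, W = x₃x₆, R = x₁x₃x₅, T = x₂x₄x₆. Then Tr(M) = α + βU + β + γW + γT + γ + γV, and Tr(M²) = α² + 2αβU + 2αγT + 2αγV + β²U² + 2β²U + β² + 2βγW + 2βγUT + 2βγT + 2βγUW + 2βγR + 2βγUV + γ²W² + γ²T² + 2γ²WT + 2γ²W + 2γ²T + γ² + γ²V² + 2γ²V + 2γ²VW + 2γ²VT. -/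
open Matrix

/-- Trace identities for the topological monodromy M = H₁S₆S₅S₄S₃S₂S₁ of the JKTVI system. -/
theorem stmt_3 (α β γ x₁ x₂ x₃ x₄ x₅ x₆ U V W R T : ℂ)
    (hU : U = x₁ * x₄) (hV : V = x₂ * x₅) (hW : W = x₃ * x₆)
    (hR : R = x₁ * x₃ * x₅) (hT : T = x₂ * x₄ * x₆)
    (H₁ S₁ S₂ S₃ S₄ S₅ S₆ M : Matrix (Fin 3) (Fin 3) ℂ)
    (hH₁ : H₁ = !![α, 0, 0; 0, β, 0; 0, 0, γ])
    (hS₁ : S₁ = !![1, x₁, 0; 0, 1, 0; 0, 0, 1])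
    (hS₂ : S₂ = !![1, 0, x₂; 0, 1, 0; 0, 0, 1])
    (hS₃ : S₃ = !![1, 0, 0; 0, 1, x₃; 0, 0, 1])
    (hS₄ : S₄ = !![1, 0, 0; x₄, 1, 0; 0, 0, 1])
    (hS₅ : S₅ = !![1, 0, 0; 0, 1, 0; x₅, 0, 1])
    (hS₆ : S₆ = !![1, 0, 0; 0, 1, 0; 0, x₆, 1])
    (hM : M = H₁ * S₆ * S₅ * S₄ * S₃ * S₂ * S₁) :
    M.trace = α + β * U + β + γ * W + γ * T + γ + γ * V ∧
    (M * M).trace =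
      α ^ 2 + 2 * α * β * U + 2 * α * γ * T + 2 * α * γ * V + β ^ 2 * U ^ 2
      + 2 * β ^ 2 * U + β ^ 2 + 2 * β * γ * W + 2 * β * γ * U * T
      + 2 * β * γ * T + 2 * β * γ * U * W + 2 * β * γ * R + 2 * β * γ * U * V
      + γ ^ 2 * W ^ 2 + γ ^ 2 * T ^ 2 + 2 * γ ^ 2 * W * T + 2 * γ ^ 2 * W
      + 2 * γ ^ 2 * T + γ ^ 2 + γ ^ 2 * V ^ 2 + 2 * γ ^ 2 * V
      + 2 * γ ^ 2 * V * W + 2 * γ ^ 2 * V * T := by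
  subst hU hV hW hR hT hH₁ hS₁ hS₂ hS₃ hS₄ hS₅ hS₆ hM
  constructor <;>
    simp [Matrix.trace, Fin.sum_univ_three] <;>
    ring
end

section
/- Let α ∈ ℂ* and x₁, x₂, x₃, x₅, x₆ ∈ ℂ. Define the 3×3 complex matrices H₂ = [[0,−α⁻¹,0],[1,0,0],[0,0,α]], S₁ = [[1,0,x₂],[0,1,x₃],[0,0,1]], S₂ = [[1,x₁,0],[0,1,0],[0,0,1]], S₃ = [[1,0,0],[0,1,0],[x₅,x₆,1]], and let M = H₂S₃S₂S₁. Set U = x₂x₅, V = x₃x₆, W = x₁, R = x₂x₆, T = x₃x₅. Then Tr(M) = α + αU + W + αV + αTW, and Tr(M²) = −2α⁻¹ − 2T + 2αR + 2αVW + W² + 2αWU + 2αW²T + α²V² + 2α²V + α² + α²U² + α²W²T² + 2α²WUT + 2α²U + 2α²WT + 2α²VWT + 2α²UV. -/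
open Matrix

/-- Trace identities for the topological monodromy M = H₂S₃S₂S₁ of the JKTV system. -/
theorem stmt_5 (α : ℂ) (hα : α ≠ 0) (x₁ x₂ x₃ x₅ x₆ U V W R T : ℂ)
    (hU : U = x₂ * x₅) (hV : V = x₃ * x₆) (hW : W = x₁)
    (hR : R = x₂ * x₆) (hT : T = x₃ * x₅)
    (H₂ S₁ S₂ S₃ M : Matrix (Fin 3) (Fin 3) ℂ)
    (hH₂ : H₂ = !![0, -α⁻¹, 0; 1, 0, 0; 0, 0, α])
    (hS₁ : S₁ = !![1, 0, x₂; 0, 1, x₃; 0, 0, 1])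
    (hS₂ : S₂ = !![1, x₁, 0; 0, 1, 0; 0, 0, 1])
    (hS₃ : S₃ = !![1, 0, 0; 0, 1, 0; x₅, x₆, 1])
    (hM : M = H₂ * S₃ * S₂ * S₁) :
    M.trace = α + α * U + W + α * V + α * T * W ∧
    (M * M).trace =
      -2 * α⁻¹ - 2 * T + 2 * α * R + 2 * α * V * W + W ^ 2 + 2 * α * W * U
      + 2 * α * W ^ 2 * T + α ^ 2 * V ^ 2 + 2 * α ^ 2 * V + α ^ 2
      + α ^ 2 * U ^ 2 + α ^ 2 * W ^ 2 * T ^ 2 + 2 * α ^ 2 * W * U * T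
      + 2 * α ^ 2 * U + 2 * α ^ 2 * W * T + 2 * α ^ 2 * V * W * T
      + 2 * α ^ 2 * U * V := by
  subst hU hV hW hR hT hH₂ hS₁ hS₂ hS₃ hM
  constructor
  · simp [Matrix.trace_fin_three]
    ring
  · simp [Matrix.trace_fin_three]
    field_simp
    ring
end

section
/- Let α ∈ ℂ* and p, q ∈ ℂ, and set c = (q − p²)/2. Suppose U, V, W, R, T ∈ ℂ satisfy (i) α + αU + W + αV + αTW = p, (ii) −2α⁻¹ − 2T + 2αR + 2αVW + W² + 2αWU + 2αW²T + α²V² + 2α²V + α² + α²U² + α²W²T² + 2α²WUT + 2α²U + 2α²WT + 2α²VWT + 2α²UV = q, and (iii) UV = RT. Then αTVW + αV² + T² + VW + αTW + V(α − p) + T(c + α⁻¹) = 0. -/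
/-- Elimination of U and R from the JKTV trace conditions yields a cubic relation. -/
theorem stmt_6 (α : ℂ) (hα : α ≠ 0) (p q c : ℂ) (hc : c = (q - p ^ 2) / 2)
    (U V W R T : ℂ)
    (h1 : α + α * U + W + α * V + α * T * W = p)
    (h2 : -2 * α⁻¹ - 2 * T + 2 * α * R + 2 * α * V * W + W ^ 2 + 2 * α * W * U
      + 2 * α * W ^ 2 * T + α ^ 2 * V ^ 2 + 2 * α ^ 2 * V + α ^ 2
      + α ^ 2 * U ^ 2 + α ^ 2 * W ^ 2 * T ^ 2 + 2 * α ^ 2 * W * U * T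
      + 2 * α ^ 2 * U + 2 * α ^ 2 * W * T + 2 * α ^ 2 * V * W * T
      + 2 * α ^ 2 * U * V = q)
    (h3 : U * V = R * T) :
    α * T * V * W + α * V ^ 2 + T ^ 2 + V * W + α * T * W
      + V * (α - p) + T * (c + α⁻¹) = 0 := by
  have hc' : c + α⁻¹ = α * R - T - α * W := by
    rw [hc, ← h1, ← h2]
    ring
  rw [hc', ← h1]
  linear_combination -α * h3
end

section
/- Let α ∈ ℂ*, let σ ∈ ℂ with σ² = α, and let p, q ∈ ℂ. Then there exist constants c₁, c₂, c₃, c₄ ∈ ℂ (depending only on p, q, α, σ) such that: for all U, V, W, R, T ∈ ℂ satisfying (i) α + αU + W + αV + αTW = p, (ii) −2α⁻¹ − 2T + 2αR + 2αVW + W² + 2αWU + 2αW²T + α²V² + 2α²V + α² + α²U² + α²W²T² + 2α²WUT + 2α²U + 2α²WT + 2α²VWT + 2α²UV = q, and (iii) UV = RT, the point X = T + α⁻¹, Y = σ(V + 1), Z = σW satisfies XYZ + X² + Y² + c₁X + c₂Y + c₃Z + c₄ = 0. -/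
/-- The JKTV wild character variety is an affine cubic surface of Painlevé V type. -/
theorem stmt_7 (α σ : ℂ) (hα : α ≠ 0) (hσ : σ ^ 2 = α) (p q : ℂ) :
    ∃ c₁ c₂ c₃ c₄ : ℂ, ∀ U V W R T : ℂ,
      α + α * U + W + α * V + α * T * W = p →
      -2 * α⁻¹ - 2 * T + 2 * α * R + 2 * α * V * W + W ^ 2 + 2 * α * W * U
        + 2 * α * W ^ 2 * T + α ^ 2 * V ^ 2 + 2 * α ^ 2 * V + α ^ 2
        + α ^ 2 * U ^ 2 + α ^ 2 * W ^ 2 * T ^ 2 + 2 * α ^ 2 * W * U * T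
        + 2 * α ^ 2 * U + 2 * α ^ 2 * W * T + 2 * α ^ 2 * V * W * T
        + 2 * α ^ 2 * U * V = q →
      U * V = R * T →
      ∀ X Y Z : ℂ, X = T + α⁻¹ → Y = σ * (V + 1) → Z = σ * W →
        X * Y * Z + X ^ 2 + Y ^ 2 + c₁ * X + c₂ * Y + c₃ * Z + c₄ = 0 := by
  subst hσ
  have hσ0 : σ ≠ 0 := fun h => hα (by simp [h])
  refine ⟨(q - p ^ 2) / 2 - (σ ^ 2)⁻¹, -(p + σ ^ 2) * σ⁻¹, -σ⁻¹,
    p - (q - p ^ 2) / 2 * (σ ^ 2)⁻¹, ?_⟩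
  rintro U V W R T trace_eq trace_sq_eq monomial_eq X Y Z rfl rfl rfl
  have inv_σ_mul (x : ℂ) : σ⁻¹ * (σ * x) = x := inv_mul_cancel_left₀ hσ0 x
  have inv_sq_mul : σ ^ 2 * (σ ^ 2)⁻¹ = 1 := mul_inv_cancel₀ hα
  linear_combination -σ ^ 2 * monomial_eq
    + (V + T / 2 * (σ ^ 2 + σ ^ 2 * U + W + σ ^ 2 * V + σ ^ 2 * T * W + p)) * trace_eq
    - T / 2 * trace_sq_eq - (p + σ ^ 2) * inv_σ_mul (V + 1) - inv_σ_mul W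
    + W * (V + 1) * inv_sq_mul
end

section
/- Let α, β, γ ∈ ℂ* with αβγ = 1 and let x₁,...,x₁₂ ∈ ℂ. Define the 3×3 complex matrices H₁ = diag(α,β,γ), S₁ = [[1,x₁,0],[0,1,0],[0,0,1]], S₂ = [[1,0,x₂],[0,1,0],[0,0,1]], S₃ = [[1,0,0],[0,1,x₃],[0,0,1]], S₄ = [[1,0,0],[x₄,1,0],[0,0,1]], S₅ = [[1,0,0],[0,1,0],[x₅,0,1]], S₆ = [[1,0,0],[0,1,0],[0,x₆,1]], S₇ = [[1,x₇,0],[0,1,0],[0,0,1]], S₈ = [[1,0,x₈],[0,1,0],[0,0,1]], S₉ = [[1,0,0],[0,1,x₉],[0,0,1]], S₁₀ = [[1,0,0],[x₁₀,1,0],[0,0,1]], S₁₁ = [[1,0,0],[0,1,0],[x₁₁,0,1]], S₁₂ = [[1,0,0],[0,1,0],[0,x₁₂,1]]. Suppose H₁S₁₂S₁₁S₁₀S₉S₈S₇S₆S₅S₄S₃S₂S₁ = I (the identity matrix). Then the point X = x₁x₄ + 1, Y = x₂x₅ + 1, Z = x₃x₆ + 1 satisfies XYZ + Y² − γ⁻¹X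 − (α + γ⁻¹ + 1)Y − αZ + (αγ⁻¹ + α + γ⁻¹) = 0. -/
open Matrix

/-- An `LU` product that becomes unipotent upper triangular after multiplying on the right by a
lower triangular matrix with diagonal `(α, β, γ)` has its trailing principal minors determined. -/
lemma trailing_minors_of_mul_eq_one (α β γ a b c d e f k₁ k₂ k₃ u v w : ℂ)
    (h : (!![1, 0, 0; d, 1, 0; e + f * d, f, 1] * !![1, a, b; 0, 1, c; 0, 0, 1] *
      !![α, 0, 0; k₁, β, 0; k₂, k₃ * γ, γ]) * !![1, u, v; 0, 1, w; 0, 0, 1] =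
        (1 : Matrix (Fin 3) (Fin 3) ℂ)) :
    (b * e + b * d * f + c * f + 1) * γ = 1 ∧
      (a * d + b * e + 1 - a * c * e) * (β * γ) = 1 := by
  have h₁₀ := congrFun (congrFun h 1) 0
  have h₁₁ := congrFun (congrFun h 1) 1
  have h₂₀ := congrFun (congrFun h 2) 0
  have h₂₁ := congrFun (congrFun h 2) 1
  have h₂₂ := congrFun (congrFun h 2) 2
  simp [Matrix.mul_apply, Fin.sum_univ_three] at h₁₀ h₁₁ h₂₀ h₂₁ h₂₂
  have g₁₁ : (d * a + 1) * β + (d * b + c) * (k₃ * γ) = 1 := by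
    linear_combination h₁₁ - u * h₁₀
  have g₂₁ : ((e + f * d) * a + f) * β + ((e + f * d) * b + f * c + 1) * (k₃ * γ) = 0 := by
    linear_combination h₂₁ - u * h₂₀
  have g₂₂ : (b * e + b * d * f + c * f + 1) * γ = 1 := by
    linear_combination h₂₂ - v * h₂₀ - w * g₂₁
  refine ⟨g₂₂, ?_⟩
  linear_combination (b * e + b * d * f + c * f + 1) * γ * g₁₁ - (d * b + c) * γ * g₂₁ + g₂₂

/-- The identity-monodromy condition for the JKTIVb system implies that
(X,Y,Z) = (x₁x₄+1, x₂x₅+1, x₃x₆+1) lies on a Painlevé IV-type cubic surface. -/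
theorem stmt_11 (α β γ : ℂ) (hα : α ≠ 0) (hβ : β ≠ 0) (hγ : γ ≠ 0)
    (habc : α * β * γ = 1)
    (x₁ x₂ x₃ x₄ x₅ x₆ x₇ x₈ x₉ x₁₀ x₁₁ x₁₂ : ℂ)
    (H₁ S₁ S₂ S₃ S₄ S₅ S₆ S₇ S₈ S₉ S₁₀ S₁₁ S₁₂ : Matrix (Fin 3) (Fin 3) ℂ)
    (hH₁ : H₁ = !![α, 0, 0; 0, β, 0; 0, 0, γ])
    (hS₁ : S₁ = !![1, x₁, 0; 0, 1, 0; 0, 0, 1])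
    (hS₂ : S₂ = !![1, 0, x₂; 0, 1, 0; 0, 0, 1])
    (hS₃ : S₃ = !![1, 0, 0; 0, 1, x₃; 0, 0, 1])
    (hS₄ : S₄ = !![1, 0, 0; x₄, 1, 0; 0, 0, 1])
    (hS₅ : S₅ = !![1, 0, 0; 0, 1, 0; x₅, 0, 1])
    (hS₆ : S₆ = !![1, 0, 0; 0, 1, 0; 0, x₆, 1])
    (hS₇ : S₇ = !![1, x₇, 0; 0, 1, 0; 0, 0, 1])
    (hS₈ : S₈ = !![1, 0, x₈; 0, 1, 0; 0, 0, 1])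
    (hS₉ : S₉ = !![1, 0, 0; 0, 1, x₉; 0, 0, 1])
    (hS₁₀ : S₁₀ = !![1, 0, 0; x₁₀, 1, 0; 0, 0, 1])
    (hS₁₁ : S₁₁ = !![1, 0, 0; 0, 1, 0; x₁₁, 0, 1])
    (hS₁₂ : S₁₂ = !![1, 0, 0; 0, 1, 0; 0, x₁₂, 1])
    (hmon : H₁ * S₁₂ * S₁₁ * S₁₀ * S₉ * S₈ * S₇ * S₆ * S₅ * S₄ * S₃ * S₂ * S₁ = 1)
    (X Y Z : ℂ)
    (hX : X = x₁ * x₄ + 1) (hY : Y = x₂ * x₅ + 1) (hZ : Z = x₃ * x₆ + 1) :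
    X * Y * Z + Y ^ 2 - γ⁻¹ * X - (α + γ⁻¹ + 1) * Y - α * Z
      + (α * γ⁻¹ + α + γ⁻¹) = 0 := by
  have hL : S₆ * S₅ * S₄ = !![1, 0, 0; x₄, 1, 0; x₅ + x₆ * x₄, x₆, 1] := by
    subst hS₄ hS₅ hS₆
    ext i j
    fin_cases i <;> fin_cases j <;> simp [Matrix.mul_apply, Fin.sum_univ_three]
  have hU : S₃ * S₂ * S₁ = !![1, x₁, x₂; 0, 1, x₃; 0, 0, 1] := by
    subst hS₁ hS₂ hS₃
    ext i j
    fin_cases i <;> fin_cases j <;> simp [Matrix.mul_apply, Fin.sum_univ_three]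
  have hU' : S₉ * S₈ * S₇ = !![1, x₇, x₈; 0, 1, x₉; 0, 0, 1] := by
    subst hS₇ hS₈ hS₉
    ext i j
    fin_cases i <;> fin_cases j <;> simp [Matrix.mul_apply, Fin.sum_univ_three]
  have hK : H₁ * S₁₂ * S₁₁ * S₁₀ =
      !![α, 0, 0; β * x₁₀, β, 0; γ * x₁₁ + γ * x₁₂ * x₁₀, x₁₂ * γ, γ] := by
    subst hH₁ hS₁₀ hS₁₁ hS₁₂
    ext i j
    fin_cases i <;> fin_cases j <;> simp [Matrix.mul_apply, Fin.sum_univ_three, mul_comm]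
  have hcyc : (S₆ * S₅ * S₄ * (S₃ * S₂ * S₁) * (H₁ * S₁₂ * S₁₁ * S₁₀)) *
      (S₉ * S₈ * S₇) = 1 := by
    have h : (H₁ * S₁₂ * S₁₁ * S₁₀ * (S₉ * S₈ * S₇)) * (S₆ * S₅ * S₄ * (S₃ * S₂ * S₁)) = 1 := by
      simpa only [Matrix.mul_assoc] using hmon
    simpa only [Matrix.mul_assoc] using mul_eq_one_comm.mp h
  rw [hL, hU, hU', hK] at hcyc
  obtain ⟨h₁, h₂⟩ := trailing_minors_of_mul_eq_one _ _ _ _ _ _ _ _ _ _ _ _ _ _ _ hcyc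
  have hg : γ⁻¹ = x₂ * x₅ + x₂ * x₄ * x₆ + x₃ * x₆ + 1 := (eq_inv_of_mul_eq_one_left h₁).symm
  have ha : α = x₁ * x₄ + x₂ * x₅ + 1 - x₁ * x₃ * x₅ :=
    mul_right_cancel₀ (mul_ne_zero hβ hγ) (by linear_combination habc - h₂)
  rw [hg, ha, hX, hY, hZ]
  ring
end

section
/- Let α, β, γ ∈ ℂ* with αβγ = 1 and let U, V, W, R, T ∈ ℂ. Suppose (i) γW + γT + γV + γ = 1, (ii) U + 1 = γ(UW + W + R + UT + T + UV) + β⁻¹, and (iii) UVW = RT. Then UVW + V² + UV + UW + VW + U(1 − γ⁻¹) + V(2 − α − γ⁻¹) + W(1 − α) + (1 − α)(1 − γ⁻¹) = 0. -/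
/-- The cubic relation among the torus-invariant Stokes coordinates of the JKTIVb system. -/
theorem stmt_12 (α β γ : ℂ) (hα : α ≠ 0) (hβ : β ≠ 0) (hγ : γ ≠ 0)
    (habc : α * β * γ = 1) (U V W R T : ℂ)
    (h1 : γ * W + γ * T + γ * V + γ = 1)
    (h2 : U + 1 = γ * (U * W + W + R + U * T + T + U * V) + β⁻¹)
    (h3 : U * V * W = R * T) :
    U * V * W + V ^ 2 + U * V + U * W + V * W + U * (1 - γ⁻¹)
      + V * (2 - α - γ⁻¹) + W * (1 - α) + (1 - α) * (1 - γ⁻¹) = 0 := by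
  have hT : T = γ⁻¹ - 1 - W - V := by
    field_simp
    linear_combination h1
  have hβ' : β⁻¹ = α * γ := by
    field_simp
    linear_combination -habc
  have hR : R = U + V + 1 - α := by
    apply mul_left_cancel₀ hγ
    rw [hβ'] at h2
    linear_combination -h2 - (U + 1) * h1
  rw [hR, hT] at h3
  linear_combination h3
end

section
/- Let α, γ ∈ ℂ* and X, Y, Z ∈ ℂ, and set X' = α⁻¹X, Y' = α⁻¹γY, Z' = γZ. Then XYZ + Y² − γ⁻¹X − (α + γ⁻¹ + 1)Y − αZ + (αγ⁻¹ + α + γ⁻¹) = 0 holds if and only if X'Y'Z' + Y'² − α⁻¹γX' − (α⁻¹γ + γ + α⁻¹)Y' − α⁻¹γZ' + (α⁻²γ + α⁻¹γ² + α⁻¹γ) = 0 holds. -/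
/-- Rescaling of the JKTIVb cubic into van der Put–Saito's Painlevé IV normal form. -/
theorem stmt_13 (α γ : ℂ) (hα : α ≠ 0) (hγ : γ ≠ 0) (X Y Z X' Y' Z' : ℂ)
    (hX : X' = α⁻¹ * X) (hY : Y' = α⁻¹ * γ * Y) (hZ : Z' = γ * Z) :
    (X * Y * Z + Y ^ 2 - γ⁻¹ * X - (α + γ⁻¹ + 1) * Y - α * Z
      + (α * γ⁻¹ + α + γ⁻¹) = 0) ↔
    (X' * Y' * Z' + Y' ^ 2 - α⁻¹ * γ * X' - (α⁻¹ * γ + γ + α⁻¹) * Y'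
      - α⁻¹ * γ * Z' + (α⁻¹ ^ 2 * γ + α⁻¹ * γ ^ 2 + α⁻¹ * γ) = 0) := by
  have key : X' * Y' * Z' + Y' ^ 2 - α⁻¹ * γ * X' - (α⁻¹ * γ + γ + α⁻¹) * Y'
      - α⁻¹ * γ * Z' + (α⁻¹ ^ 2 * γ + α⁻¹ * γ ^ 2 + α⁻¹ * γ) =
      (α⁻¹ * γ) ^ 2 * (X * Y * Z + Y ^ 2 - γ⁻¹ * X - (α + γ⁻¹ + 1) * Y - α * Z
        + (α * γ⁻¹ + α + γ⁻¹)) := by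
    subst hX hY hZ
    field_simp
    ring
  have hscale : (α⁻¹ * γ) ^ 2 ≠ 0 := pow_ne_zero 2 (mul_ne_zero (inv_ne_zero hα) hγ)
  rw [key, mul_eq_zero_iff_left hscale]
end

section
/- Let α ∈ ℂ* and x₁, x₂, x₃, x₄, x₅, x₆, x₇, x₈, x₉, x₁₁, x₁₂ ∈ ℂ. Define the 3×3 complex matrices H₂ = [[0,−α⁻¹,0],[1,0,0],[0,0,α]], S₁ = [[1,0,x₂],[0,1,x₃],[0,0,1]], S₂ = [[1,x₁,0],[0,1,0],[0,0,1]], S₃ = [[1,0,0],[0,1,0],[x₅,x₆,1]], S₄ = [[1,0,0],[x₄,1,0],[0,0,1]], S₅ = [[1,0,x₈],[0,1,x₉],[0,0,1]], S₆ = [[1,x₇,0],[0,1,0],[0,0,1]], S₇ = [[1,0,0],[0,1,0],[x₁₁,x₁₂,1]]. Suppose H₂S₇S₆S₅S₄S₃S₂S₁ = I (the identity matrix). Then the point X = x₂x₅ + 1, Y = α(x₃x₆ + 1), Z = x₁ satisfies XYZ − X − α⁻¹Y − Z + 1 + α⁻¹ = 0. -/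
open Matrix

/-- The identity-monodromy condition for the JKTII system implies that
(X,Y,Z) = (x₂x₅+1, α(x₃x₆+1), x₁) lies on the Painlevé II-type cubic surface. -/
theorem stmt_14 (α : ℂ) (hα : α ≠ 0)
    (x₁ x₂ x₃ x₄ x₅ x₆ x₇ x₈ x₉ x₁₁ x₁₂ : ℂ)
    (H₂ S₁ S₂ S₃ S₄ S₅ S₆ S₇ : Matrix (Fin 3) (Fin 3) ℂ)
    (hH₂ : H₂ = !![0, -α⁻¹, 0; 1, 0, 0; 0, 0, α])
    (hS₁ : S₁ = !![1, 0, x₂; 0, 1, x₃; 0, 0, 1])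
    (hS₂ : S₂ = !![1, x₁, 0; 0, 1, 0; 0, 0, 1])
    (hS₃ : S₃ = !![1, 0, 0; 0, 1, 0; x₅, x₆, 1])
    (hS₄ : S₄ = !![1, 0, 0; x₄, 1, 0; 0, 0, 1])
    (hS₅ : S₅ = !![1, 0, x₈; 0, 1, x₉; 0, 0, 1])
    (hS₆ : S₆ = !![1, x₇, 0; 0, 1, 0; 0, 0, 1])
    (hS₇ : S₇ = !![1, 0, 0; 0, 1, 0; x₁₁, x₁₂, 1])
    (hmon : H₂ * S₇ * S₆ * S₅ * S₄ * S₃ * S₂ * S₁ = 1)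
    (X Y Z : ℂ)
    (hX : X = x₂ * x₅ + 1) (hY : Y = α * (x₃ * x₆ + 1)) (hZ : Z = x₁) :
    X * Y * Z - X - α⁻¹ * Y - Z + 1 + α⁻¹ = 0 := by
  have hcyc : S₄ * S₃ * S₂ * S₁ * H₂ * (S₇ * S₆ * S₅) = 1 := by
    have h : (H₂ * (S₇ * S₆ * S₅)) * (S₄ * S₃ * S₂ * S₁) = 1 := by
      simpa only [Matrix.mul_assoc] using hmon
    simpa only [Matrix.mul_assoc] using mul_eq_one_comm.mp h
  have hinv : S₇ * S₆ * S₅ *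
      (!![1, -x₇, -x₈; 0, 1, -x₉; 0, 0, 1] * !![1, 0, 0; 0, 1, 0; -x₁₁, -x₁₂, 1]) = 1 := by
    subst hS₅ hS₆ hS₇
    ext i j
    fin_cases i <;> fin_cases j <;> simp [Matrix.mul_apply, Fin.sum_univ_three] <;> ring
  have hfac : S₄ * S₃ * S₂ * S₁ * H₂ =
      !![1, -x₇, -x₈; 0, 1, -x₉; 0, 0, 1] * !![1, 0, 0; 0, 1, 0; -x₁₁, -x₁₂, 1] :=
    left_inv_eq_right_inv hcyc hinv
  subst hH₂ hS₁ hS₂ hS₃ hS₄ hX hY hZ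
  have h11 := congrFun (congrFun hfac 0) 0
  have h13 := congrFun (congrFun hfac 0) 2
  have h31 := congrFun (congrFun hfac 2) 0
  have h33 := congrFun (congrFun hfac 2) 2
  simp [Matrix.mul_apply, Fin.sum_univ_three] at h11 h13 h31 h33
  have hZ_eq : α * (Z - x₂ * x₆) = 1 := by
    linear_combination h11 - (x₅ * Z + x₆) * h13 + x₈ * h31 + Z * h33
  have hα_inv : α⁻¹ = x₅ * x₂ + ((x₅ * Z + x₆) * x₃ + 1) :=
    (eq_inv_of_mul_eq_one_left h33).symm
  rw [inv_mul_cancel_left₀ hα]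
  linear_combination hα_inv + Z * h33 - Z * x₃ * x₅ * hZ_eq
end

section
/- Let x₁,...,x₁₀ ∈ ℂ. Define the 3×3 complex matrices H₃ = [[0,0,1],[1,0,0],[0,1,0]], S₁ = [[1,x₁,0],[0,1,0],[0,0,1]], S₂ = [[1,0,x₂],[0,1,0],[0,0,1]], S₃ = [[1,0,0],[0,1,x₃],[0,0,1]], S₄ = [[1,0,0],[x₄,1,0],[0,0,1]], S₅ = [[1,0,0],[0,1,0],[x₅,0,1]], S₆ = [[1,0,0],[0,1,0],[0,x₆,1]], S₇ = [[1,x₇,0],[0,1,0],[0,0,1]], S₈ = [[1,0,x₈],[0,1,0],[0,0,1]], S₉ = [[1,0,0],[0,1,x₉],[0,0,1]], S₁₀ = [[1,0,0],[x₁₀,1,0],[0,0,1]]. Suppose H₃S₁₀S₉S₈S₇S₆S₅S₄S₃S₂S₁ = I (the identity matrix). Then the point X = −x₁, Y = x₂, Z = −x₄ satisfies XYZ + X + Y + 1 = 0. -/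
open Matrix

/-- The identity-monodromy condition for the JKTI system implies that
(X,Y,Z) = (−x₁, x₂, −x₄) lies on the Painlevé I-type cubic surface. -/
theorem stmt_16 (x₁ x₂ x₃ x₄ x₅ x₆ x₇ x₈ x₉ x₁₀ : ℂ)
    (H₃ S₁ S₂ S₃ S₄ S₅ S₆ S₇ S₈ S₉ S₁₀ : Matrix (Fin 3) (Fin 3) ℂ)
    (hH₃ : H₃ = !![0, 0, 1; 1, 0, 0; 0, 1, 0])
    (hS₁ : S₁ = !![1, x₁, 0; 0, 1, 0; 0, 0, 1])
    (hS₂ : S₂ = !![1, 0, x₂; 0, 1, 0; 0, 0, 1])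
    (hS₃ : S₃ = !![1, 0, 0; 0, 1, x₃; 0, 0, 1])
    (hS₄ : S₄ = !![1, 0, 0; x₄, 1, 0; 0, 0, 1])
    (hS₅ : S₅ = !![1, 0, 0; 0, 1, 0; x₅, 0, 1])
    (hS₆ : S₆ = !![1, 0, 0; 0, 1, 0; 0, x₆, 1])
    (hS₇ : S₇ = !![1, x₇, 0; 0, 1, 0; 0, 0, 1])
    (hS₈ : S₈ = !![1, 0, x₈; 0, 1, 0; 0, 0, 1])
    (hS₉ : S₉ = !![1, 0, 0; 0, 1, x₉; 0, 0, 1])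
    (hS₁₀ : S₁₀ = !![1, 0, 0; x₁₀, 1, 0; 0, 0, 1])
    (hmon : H₃ * S₁₀ * S₉ * S₈ * S₇ * S₆ * S₅ * S₄ * S₃ * S₂ * S₁ = 1)
    (X Y Z : ℂ) (hX : X = -x₁) (hY : Y = x₂) (hZ : Z = -x₄) :
    X * Y * Z + X + Y + 1 = 0 := by
  -- Move the first five factors to the right-hand side and compare the upper two rows.
  set A : Matrix (Fin 3) (Fin 3) ℂ := H₃ * S₁₀ * S₉ * S₈ * S₇ with hA
  set B : Matrix (Fin 3) (Fin 3) ℂ := S₆ * S₅ * S₄ * S₃ * S₂ * S₁ with hB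
  have hAB : A * B = 1 := by
    rw [← hmon]
    simp only [hA, hB, Matrix.mul_assoc]
  have hinv : !![x₇ * x₉ - x₈, 1 + x₇ * x₁₀, -x₇; -x₉, -x₁₀, 1; 1, 0, 0] * A = 1 := by
    rw [hA, hH₃, hS₁₀, hS₉, hS₈, hS₇]
    ext i j
    fin_cases i <;> fin_cases j <;> simp [Matrix.mul_apply, Fin.sum_univ_three] <;> ring
  have hBinv : B = !![x₇ * x₉ - x₈, 1 + x₇ * x₁₀, -x₇; -x₉, -x₁₀, 1; 1, 0, 0] :=
    (left_inv_eq_right_inv hinv hAB).symm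
  rw [hB, hS₆, hS₅, hS₄, hS₃, hS₂, hS₁] at hBinv
  have h01 : x₁ = 1 + x₇ * x₁₀ := by
    simpa [Matrix.mul_apply, Fin.sum_univ_three] using congrFun₂ hBinv 0 1
  have h02 : x₂ = -x₇ := by
    simpa [Matrix.mul_apply, Fin.sum_univ_three] using congrFun₂ hBinv 0 2
  have h11 : x₄ * x₁ + 1 = -x₁₀ := by
    simpa [Matrix.mul_apply, Fin.sum_univ_three] using congrFun₂ hBinv 1 1
  rw [hX, hY, hZ]
  linear_combination -h01 + x₂ * h11 - x₁₀ * h02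
end

section
/- With the 3×3 complex matrices H₃ = [[0,0,1],[1,0,0],[0,1,0]], S₁ = [[1,x₁,0],[0,1,0],[0,0,1]], S₂ = [[1,0,x₂],[0,1,0],[0,0,1]], S₃ = [[1,0,0],[0,1,x₃],[0,0,1]], S₄ = [[1,0,0],[x₄,1,0],[0,0,1]], S₅ = [[1,0,0],[0,1,0],[x₅,0,1]], S₆ = [[1,0,0],[0,1,0],[0,x₆,1]], S₇ = [[1,x₇,0],[0,1,0],[0,0,1]], S₈ = [[1,0,x₈],[0,1,0],[0,0,1]], S₉ = [[1,0,0],[0,1,x₉],[0,0,1]], S₁₀ = [[1,0,0],[x₁₀,1,0],[0,0,1]], the map (x₁,...,x₁₀) ↦ (−x₁, x₂, −x₄) is a bijection from the set {(x₁,...,x₁₀) ∈ ℂ¹⁰ : H₃S₁₀S₉S₈S₇S₆S₅S₄S₃S₂S₁ = I} onto the affine cubic surface {(X,Y,Z) ∈ ℂ³ : XYZ + X + Y + 1 = 0}. -/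
open Matrix

/-- The monodromy equation moved to the form `S₆ S₅ S₄ S₃ S₂ S₁ = (H₃ S₁₀ S₉ S₈ S₇)⁻¹`, with both
sides multiplied out. -/
theorem stokes_monodromy_eq_one_iff_matrix_eq (x : Fin 10 → ℂ) :
    (!![0, 0, 1; 1, 0, 0; 0, 1, 0] : Matrix (Fin 3) (Fin 3) ℂ)
        * !![1, 0, 0; x 9, 1, 0; 0, 0, 1]
        * !![1, 0, 0; 0, 1, x 8; 0, 0, 1]
        * !![1, 0, x 7; 0, 1, 0; 0, 0, 1]
        * !![1, x 6, 0; 0, 1, 0; 0, 0, 1]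
        * !![1, 0, 0; 0, 1, 0; 0, x 5, 1]
        * !![1, 0, 0; 0, 1, 0; x 4, 0, 1]
        * !![1, 0, 0; x 3, 1, 0; 0, 0, 1]
        * !![1, 0, 0; 0, 1, x 2; 0, 0, 1]
        * !![1, 0, x 1; 0, 1, 0; 0, 0, 1]
        * !![1, x 0, 0; 0, 1, 0; 0, 0, 1] = 1 ↔
      (!![1, x 0, x 1; x 3, 1 + x 3 * x 0, x 2 + x 3 * x 1;
          x 4 + x 5 * x 3, x 4 * x 0 + x 5 * (1 + x 3 * x 0),
          1 + x 4 * x 1 + x 5 * (x 2 + x 3 * x 1)] : Matrix (Fin 3) (Fin 3) ℂ) =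
        !![x 6 * x 8 - x 7, 1 + x 6 * x 9, -x 6; -x 8, -x 9, 1; 1, 0, 0] := by
  set P : Matrix (Fin 3) (Fin 3) ℂ := !![0, 0, 1; 1, 0, 0; 0, 1, 0]
        * !![1, 0, 0; x 9, 1, 0; 0, 0, 1]
        * !![1, 0, 0; 0, 1, x 8; 0, 0, 1]
        * !![1, 0, x 7; 0, 1, 0; 0, 0, 1]
        * !![1, x 6, 0; 0, 1, 0; 0, 0, 1] with hP
  have hL : (!![1, 0, 0; 0, 1, 0; 0, x 5, 1] : Matrix (Fin 3) (Fin 3) ℂ)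
        * !![1, 0, 0; 0, 1, 0; x 4, 0, 1]
        * !![1, 0, 0; x 3, 1, 0; 0, 0, 1]
        * !![1, 0, 0; 0, 1, x 2; 0, 0, 1]
        * !![1, 0, x 1; 0, 1, 0; 0, 0, 1]
        * !![1, x 0, 0; 0, 1, 0; 0, 0, 1] =
      !![1, x 0, x 1; x 3, 1 + x 3 * x 0, x 2 + x 3 * x 1;
          x 4 + x 5 * x 3, x 4 * x 0 + x 5 * (1 + x 3 * x 0),
          1 + x 4 * x 1 + x 5 * (x 2 + x 3 * x 1)] := by
    ext i j
    fin_cases i <;> fin_cases j <;> simp [Matrix.mul_apply, Fin.sum_univ_three] <;> ring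
  have hPR : P * !![x 6 * x 8 - x 7, 1 + x 6 * x 9, -x 6; -x 8, -x 9, 1; 1, 0, 0] = 1 := by
    rw [hP]
    ext i j
    fin_cases i <;> fin_cases j <;> simp [Matrix.mul_apply, Fin.sum_univ_three] <;> ring
  have hRP := mul_eq_one_comm.mp hPR
  simp only [mul_assoc P]
  rw [hL]
  refine ⟨fun h => ?_, fun h => h ▸ hPR⟩
  exact (left_inv_eq_right_inv hRP h).symm

/-- The monodromy equation solved for all Stokes parameters in terms of `x₁`, `x₂`, `x₄`. -/
theorem stokes_monodromy_eq_one_iff (x : Fin 10 → ℂ) :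
    (!![0, 0, 1; 1, 0, 0; 0, 1, 0] : Matrix (Fin 3) (Fin 3) ℂ)
        * !![1, 0, 0; x 9, 1, 0; 0, 0, 1]
        * !![1, 0, 0; 0, 1, x 8; 0, 0, 1]
        * !![1, 0, x 7; 0, 1, 0; 0, 0, 1]
        * !![1, x 6, 0; 0, 1, 0; 0, 0, 1]
        * !![1, 0, 0; 0, 1, 0; 0, x 5, 1]
        * !![1, 0, 0; 0, 1, 0; x 4, 0, 1]
        * !![1, 0, 0; x 3, 1, 0; 0, 0, 1]
        * !![1, 0, 0; 0, 1, x 2; 0, 0, 1]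
        * !![1, 0, x 1; 0, 1, 0; 0, 0, 1]
        * !![1, x 0, 0; 0, 1, 0; 0, 0, 1] = 1 ↔
      x 0 * x 1 * x 3 - x 0 + x 1 + 1 = 0 ∧
        x = ![x 0, x 1, 1 - x 1 * x 3, x 3, 1 + x 0 * x 3, -x 0, -x 1, x 1 * x 3 - 1, -x 3,
          -(1 + x 0 * x 3)] := by
  rw [stokes_monodromy_eq_one_iff_matrix_eq]
  constructor
  · intro h
    have e (i j : Fin 3) := congrFun (congrFun h i) j
    have h00 := e 0 0
    have h01 := e 0 1
    have h02 := e 0 2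
    have h10 := e 1 0
    have h11 := e 1 1
    have h12 := e 1 2
    have h20 := e 2 0
    have h21 := e 2 1
    simp at h00 h01 h02 h10 h11 h12 h20 h21
    have h5 : x 5 = -x 0 := by linear_combination h21 - x 0 * h20
    refine ⟨by grind, ?_⟩
    ext i
    fin_cases i <;> simp <;> grind
  · rintro ⟨hs, hx⟩
    have h2 : x 2 = 1 - x 1 * x 3 := congrFun hx 2
    have h4 : x 4 = 1 + x 0 * x 3 := congrFun hx 4
    have h5 : x 5 = -x 0 := congrFun hx 5
    have h6 : x 6 = -x 1 := congrFun hx 6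
    have h7 : x 7 = x 1 * x 3 - 1 := congrFun hx 7
    have h8 : x 8 = -x 3 := congrFun hx 8
    have h9 : x 9 = -(1 + x 0 * x 3) := congrFun hx 9
    rw [h2, h4, h5, h6, h7, h8, h9]
    ext i j
    fin_cases i <;> fin_cases j <;> simp <;> grind

/-- The map (x₁,...,x₁₀) ↦ (−x₁, x₂, −x₄) is a bijection from the set of Stokes data of
the JKTI system with identity topological monodromy onto the affine cubic surface
{XYZ + X + Y + 1 = 0}. -/
theorem stmt_17 :
    Set.BijOn (fun x : Fin 10 → ℂ => (-x 0, x 1, -x 3))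
      {x : Fin 10 → ℂ |
        (!![0, 0, 1; 1, 0, 0; 0, 1, 0] : Matrix (Fin 3) (Fin 3) ℂ)
        * !![1, 0, 0; x 9, 1, 0; 0, 0, 1]
        * !![1, 0, 0; 0, 1, x 8; 0, 0, 1]
        * !![1, 0, x 7; 0, 1, 0; 0, 0, 1]
        * !![1, x 6, 0; 0, 1, 0; 0, 0, 1]
        * !![1, 0, 0; 0, 1, 0; 0, x 5, 1]
        * !![1, 0, 0; 0, 1, 0; x 4, 0, 1]
        * !![1, 0, 0; x 3, 1, 0; 0, 0, 1]
        * !![1, 0, 0; 0, 1, x 2; 0, 0, 1]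
        * !![1, 0, x 1; 0, 1, 0; 0, 0, 1]
        * !![1, x 0, 0; 0, 1, 0; 0, 0, 1] = 1}
      {p : ℂ × ℂ × ℂ | p.1 * p.2.1 * p.2.2 + p.1 + p.2.1 + 1 = 0} := by
  simp only [stokes_monodromy_eq_one_iff]
  refine ⟨?_, ?_, ?_⟩
  · rintro x ⟨hs, -⟩
    simp only [Set.mem_ofPred_eq]
    linear_combination hs
  · rintro x ⟨-, hx⟩ y ⟨-, hy⟩ h
    simp only [Prod.mk.injEq, neg_inj] at h
    obtain ⟨h0, h1, h3⟩ := h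
    rw [hx, hy, h0, h1, h3]
  · rintro ⟨X, Y, Z⟩ h
    simp only [Set.mem_ofPred_eq] at h
    refine ⟨![-X, Y, 1 + Y * Z, -Z, 1 + X * Z, X, -Y, -(Y * Z) - 1, Z, -(1 + X * Z)],
      ⟨?_, ?_⟩, ?_⟩
    · simp only [Matrix.cons_val]
      linear_combination h
    · ext i
      fin_cases i <;> simp
    · simp
end
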